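/- Let N > K ≥ 1, let W ∈ ℂ^{N×N}, and for each k = 1,…,K let a_k ∈ ℂ^N and let T_k ∈ ℂ^{N×N} be a diagonal matrix; set ā_k = T_k·a_k, let A = [ā_1, …, ā_K] ∈ ℂ^{N×K} and D = Wᴴ·A, and assume rank D = K. Let Π ∈ ℂ^{K×K} be Hermitian positive definite, c > 0, s > 0, and R = c·D·Π·Dᴴ + s·I_N. Let U ∈ ℂ^{N×(N−K)} be any matrix each of whose columns u satisfies R·u = s·u. Then for every k, the corrected noise-subspace matrix V_k := T_kᴴ·W·U satisfies a_kᴴ·V_k = 0; in particular a_kᴴ·V_k·V_kᴴ·a_k = 0, i.e., the beam-squint-corrected MUSIC null-spectrum vanishes at the true target parameters. -/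

import Mathlib

open Matrix
open scoped ComplexOrder

theorem corrected_music_null_spectrum (N K : ℕ) (hK : 1 ≤ K) (hNK : K < N)
    (W : Matrix (Fin N) (Fin N) ℂ)
    (a : Fin K → (Fin N → ℂ))
    (T : Fin K → Matrix (Fin N) (Fin N) ℂ) (hT : ∀ k, (T k).IsDiag)
    (A : Matrix (Fin N) (Fin K) ℂ) (hA : ∀ k, (fun n => A n k) = (T k) *ᵥ (a k))
    (D : Matrix (Fin N) (Fin K) ℂ) (hD : D = Wᴴ * A) (hrank : D.rank = K)
    (P : Matrix (Fin K) (Fin K) ℂ) (hP : P.PosDef)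
    (c s : ℝ) (hc : 0 < c) (hs : 0 < s)
    (R : Matrix (Fin N) (Fin N) ℂ)
    (hR : R = (c : ℂ) • (D * P * Dᴴ) + (s : ℂ) • (1 : Matrix (Fin N) (Fin N) ℂ))
    (U : Matrix (Fin N) (Fin (N - K)) ℂ)
    (hU : ∀ j : Fin (N - K), R *ᵥ (fun i => U i j) = (s : ℂ) • (fun i => U i j)) :
    ∀ k : Fin K,
      (star (a k)) ᵥ* ((T k)ᴴ * W * U) = 0 ∧
      star (a k) ⬝ᵥ ((((T k)ᴴ * W * U) * ((T k)ᴴ * W * U)ᴴ) *ᵥ (a k)) = 0 := by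
  have key : ∀ j, Dᴴ *ᵥ (fun i => U i j) = 0 := by
    intro j
    have h := hU j
    rw [hR, add_mulVec, smul_mulVec, smul_mulVec, one_mulVec, add_eq_right] at h
    have hc' : (c : ℂ) ≠ 0 := by exact_mod_cast hc.ne'
    have h2 := (smul_eq_zero.mp h).resolve_left hc'
    by_contra hne
    have hpos := hP.dotProduct_mulVec_pos hne
    have h0 : star (Dᴴ *ᵥ (fun i => U i j)) ⬝ᵥ (P *ᵥ (Dᴴ *ᵥ (fun i => U i j))) = 0 := by
      rw [star_mulVec, conjTranspose_conjTranspose, ← dotProduct_mulVec, mulVec_mulVec,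
        mulVec_mulVec, h2, dotProduct_zero]
    rw [h0] at hpos
    exact lt_irrefl _ hpos
  intro k
  have h1 : (star (a k)) ᵥ* ((T k)ᴴ * W * U) = 0 := by
    rw [← vecMul_vecMul, ← vecMul_vecMul, ← star_mulVec, ← hA k]
    funext j
    have h := congrFun (key j) k
    rw [hD, conjTranspose_mul, conjTranspose_conjTranspose, ← mulVec_mulVec] at h
    change (star fun n => A n k) ᵥ* W ⬝ᵥ (fun i => U i j) = 0
    rw [← dotProduct_mulVec]
    exact h
  refine ⟨h1, ?_⟩
  rw [dotProduct_mulVec, ← vecMul_vecMul, h1, zero_vecMul, zero_dotProduct]
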